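/- arXiv:1802.08480 — 7 statements merged into one kernel-verified Lean document; each statement's English description precedes it below -/
import Mathlib

section
/- Let ℓ1, ℓ2, ℓ3, φ be real numbers with ℓ2 ≠ 0, set L = ℓ1 + ℓ3 + 2, and assume L ≠ 0 and sin(φ)(ℓ1 − ℓ3) + √3·cos(φ)(L + 1) ≠ 0. Then the seven vectors X1, X2, X3, X4, X12, X13, X14 in ℝ^7 (defined in the context) are linearly independent, i.e. they span ℝ^7. -/
/- Coordinates on ℝ^7: (x, y, θ, φ, ℓ1, ℓ2, ℓ3) as indices 0,…,6. -/

noncomputable def Lconst (l1 l3 : ℝ) : ℝ := l1 + l3 + 2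

noncomputable def X1 (l1 l2 l3 φ : ℝ) : Fin 7 → ℝ :=
  ![1,
    Real.sqrt 3 * (l1 - l3) / (3 * Lconst l1 l3),
    -(1 / Lconst l1 l3),
    (Real.sin φ * Real.sqrt 3 * (l1 - l3) + 3 * Real.cos φ * (Lconst l1 l3 + 1) + 3 * l2)
      / (3 * l2 * Lconst l1 l3),
    0, 0, 0]

noncomputable def X2 : Fin 7 → ℝ := ![0, 0, 0, 0, 1, 0, 0]
noncomputable def X3 : Fin 7 → ℝ := ![0, 0, 0, 0, 0, 1, 0]
noncomputable def X4 : Fin 7 → ℝ := ![0, 0, 0, 0, 0, 0, 1]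

noncomputable def X12 (l1 l2 l3 φ : ℝ) : Fin 7 → ℝ :=
  ![0,
    -2 * (l3 + 1) / (Real.sqrt 3 * (Lconst l1 l3) ^ 2),
    -(1 / (Lconst l1 l3) ^ 2),
    (-2 * Real.sin φ * (l3 + 1) + Real.sqrt 3 * Real.cos φ + Real.sqrt 3 * l2)
      / (Real.sqrt 3 * l2 * (Lconst l1 l3) ^ 2),
    0, 0, 0]

noncomputable def X13 (l1 l2 l3 φ : ℝ) : Fin 7 → ℝ :=
  ![0, 0, 0,
    (Real.sin φ * (l1 - l3) + Real.sqrt 3 * Real.cos φ * (Lconst l1 l3 + 1))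
      / (Real.sqrt 3 * l2 ^ 2 * Lconst l1 l3),
    0, 0, 0]

noncomputable def X14 (l1 l2 l3 φ : ℝ) : Fin 7 → ℝ :=
  ![0,
    2 * (l1 + 1) / (Real.sqrt 3 * (Lconst l1 l3) ^ 2),
    -(1 / (Lconst l1 l3) ^ 2),
    (2 * Real.sin φ * (l1 + 1) + Real.sqrt 3 * Real.cos φ + Real.sqrt 3 * l2)
      / (Real.sqrt 3 * l2 * (Lconst l1 l3) ^ 2),
    0, 0, 0]

theorem linearIndependent_of_staircase {p q r a b t u v w : ℝ}
    (ht : t ≠ 0) (hab : a ≠ b) (hv : v ≠ 0) :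
    LinearIndependent ℝ
      (![![1, p, q, r, 0, 0, 0], ![0, 0, 0, 0, 1, 0, 0], ![0, 0, 0, 0, 0, 1, 0],
        ![0, 0, 0, 0, 0, 0, 1], ![0, a, t, u, 0, 0, 0], ![0, 0, 0, v, 0, 0, 0],
        ![0, b, t, w, 0, 0, 0]] : Fin 7 → Fin 7 → ℝ) := by
  rw [Fintype.linearIndependent_iff]
  intro c hc
  have hx := congrFun hc 0
  have hy := congrFun hc 1
  have hθ := congrFun hc 2
  have hφ := congrFun hc 3
  have h1 := congrFun hc 4
  have h2 := congrFun hc 5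
  have h3 := congrFun hc 6
  simp [Fin.sum_univ_succ] at hx hy hθ hφ h1 h2 h3
  simp only [Fin.forall_fin_succ]
  simp
  grind

theorem stmt_0 (l1 l2 l3 φ : ℝ) (hl2 : l2 ≠ 0) (hL : Lconst l1 l3 ≠ 0)
    (h13 : Real.sin φ * (l1 - l3) + Real.sqrt 3 * Real.cos φ * (Lconst l1 l3 + 1) ≠ 0) :
    LinearIndependent ℝ
      ![X1 l1 l2 l3 φ, X2, X3, X4, X12 l1 l2 l3 φ, X13 l1 l2 l3 φ, X14 l1 l2 l3 φ] ∧
    Submodule.span ℝ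
      (Set.range ![X1 l1 l2 l3 φ, X2, X3, X4, X12 l1 l2 l3 φ, X13 l1 l2 l3 φ, X14 l1 l2 l3 φ])
      = (⊤ : Submodule ℝ (Fin 7 → ℝ)) := by
  have hs : Real.sqrt 3 ≠ 0 := by positivity
  have hli : LinearIndependent ℝ
      ![X1 l1 l2 l3 φ, X2, X3, X4, X12 l1 l2 l3 φ, X13 l1 l2 l3 φ, X14 l1 l2 l3 φ] := by
    refine linearIndependent_of_staircase (by simpa using hL) ?_
      (div_ne_zero h13 (by positivity))
    intro h
    rw [div_left_inj' (by positivity)] at h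
    apply hL
    unfold Lconst
    linarith
  exact ⟨hli, hli.span_eq_top_of_card_eq_finrank (by simp)⟩
end

section
/- The vector fields N1, N2, N3, N4 on ℝ^7 defined in the context generate a nilpotent Lie algebra of step 2: for all indices a, b, c ∈ {1, 2, 3, 4}, the iterated Lie bracket [[N_a, N_b], N_c] is identically zero. -/
/- Coordinates on ℝ^7: (x, ℓ1, ℓ2, ℓ3, y1, y2, y3) as indices 0,…,6. -/

/-- Lie bracket of vector fields on ℝ^7: [X,Y](p) = DY(p)·X(p) − DX(p)·Y(p). -/
noncomputable def lieBracket (X Y : (Fin 7 → ℝ) → (Fin 7 → ℝ)) :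
    (Fin 7 → ℝ) → (Fin 7 → ℝ) :=
  fun p => fderiv ℝ Y p (X p) - fderiv ℝ X p (Y p)

noncomputable def N1 : (Fin 7 → ℝ) → (Fin 7 → ℝ) := fun p =>
  ![1, 0, 0, 0,
    -((-Real.sqrt 3 / 2) * p 0 + p 1 - 1),
    -(p 2 - 1),
    -((Real.sqrt 3 / 2) * p 0 + p 3 - 1)]

noncomputable def N2 : (Fin 7 → ℝ) → (Fin 7 → ℝ) := fun _ => ![0, 1, 0, 0, 0, 0, 0]
noncomputable def N3 : (Fin 7 → ℝ) → (Fin 7 → ℝ) := fun _ => ![0, 0, 1, 0, 0, 0, 0]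
noncomputable def N4 : (Fin 7 → ℝ) → (Fin 7 → ℝ) := fun _ => ![0, 0, 0, 1, 0, 0, 0]

/-- The family (N1, N2, N3, N4). -/
noncomputable def Nfam : Fin 4 → ((Fin 7 → ℝ) → (Fin 7 → ℝ)) := ![N1, N2, N3, N4]

theorem lieBracket_affine (v w : Fin 7 → ℝ) (A B : (Fin 7 → ℝ) →L[ℝ] (Fin 7 → ℝ)) :
    lieBracket (fun p => v + A p) (fun p => w + B p) =
      fun p => B (v + A p) - A (w + B p) := by
  funext p
  simp [lieBracket, fderiv_const_add]

theorem lieBracket_lieBracket_affine (v w u : Fin 7 → ℝ)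
    (A B C : (Fin 7 → ℝ) →L[ℝ] (Fin 7 → ℝ))
    (hAB : A ∘L B = 0) (hBA : B ∘L A = 0) (hCA : C ∘L A = 0) (hCB : C ∘L B = 0) :
    lieBracket (lieBracket (fun p => v + A p) (fun p => w + B p)) (fun p => u + C p) =
      fun _ => 0 := by
  have hAB_apply (p) : A (B p) = 0 := DFunLike.congr_fun hAB p
  have hBA_apply (p) : B (A p) = 0 := DFunLike.congr_fun hBA p
  have hCA_apply (p) : C (A p) = 0 := DFunLike.congr_fun hCA p
  have hCB_apply (p) : C (B p) = 0 := DFunLike.congr_fun hCB p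
  rw [lieBracket_affine]
  funext p
  simp [lieBracket, fderiv_const_add, hAB_apply, hBA_apply, hCA_apply, hCB_apply]

/-- The linear part of the affine vector field `N1`. -/
noncomputable def linearPartN1 : (Fin 7 → ℝ) →L[ℝ] (Fin 7 → ℝ) :=
  LinearMap.toContinuousLinearMap
    { toFun := fun p =>
        ![0, 0, 0, 0, Real.sqrt 3 / 2 * p 0 - p 1, -p 2, -(Real.sqrt 3 / 2 * p 0) - p 3]
      map_add' := fun p q => by
        ext i
        fin_cases i <;> simp <;> ring
      map_smul' := fun r p => by
        ext i
        fin_cases i <;> simp <;> ring }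

theorem linearPartN1_apply (p : Fin 7 → ℝ) :
    linearPartN1 p =
      ![0, 0, 0, 0, Real.sqrt 3 / 2 * p 0 - p 1, -p 2, -(Real.sqrt 3 / 2 * p 0) - p 3] :=
  rfl

theorem linearPartN1_comp_self : linearPartN1 ∘L linearPartN1 = 0 := by
  ext1 p
  ext i
  fin_cases i <;> simp [linearPartN1_apply]

theorem N1_eq_affine : N1 = fun p => ![1, 0, 0, 0, 1, 1, 1] + linearPartN1 p := by
  funext p
  ext i
  fin_cases i <;> simp [N1, linearPartN1_apply] <;> ring

theorem Nfam_eq_affine (a : Fin 4) :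
    ∃ (v : Fin 7 → ℝ) (A : (Fin 7 → ℝ) →L[ℝ] (Fin 7 → ℝ)),
      (A = linearPartN1 ∨ A = 0) ∧ Nfam a = fun p => v + A p := by
  fin_cases a
  · exact ⟨_, _, .inl rfl, N1_eq_affine⟩
  all_goals exact ⟨_, 0, .inr rfl, funext fun _ => (add_zero _).symm⟩

theorem stmt_2 :
    ∀ a b c : Fin 4,
      lieBracket (lieBracket (Nfam a) (Nfam b)) (Nfam c) = (fun _ => (0 : Fin 7 → ℝ)) := by
  intro a b c
  obtain ⟨v, A, hA, ha⟩ := Nfam_eq_affine a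
  obtain ⟨w, B, hB, hb⟩ := Nfam_eq_affine b
  obtain ⟨u, C, hC, hc⟩ := Nfam_eq_affine c
  have comp_eq_zero {S T : (Fin 7 → ℝ) →L[ℝ] (Fin 7 → ℝ)}
      (hS : S = linearPartN1 ∨ S = 0) (hT : T = linearPartN1 ∨ T = 0) : S ∘L T = 0 := by
    rcases hS with rfl | rfl <;> rcases hT with rfl | rfl <;> simp [linearPartN1_comp_self]
  rw [ha, hb, hc]
  exact lieBracket_lieBracket_affine v w u A B C (comp_eq_zero hA hB) (comp_eq_zero hB hA)
    (comp_eq_zero hC hA) (comp_eq_zero hC hB)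
end

section
/- For all real numbers k2, k3, k4, the vector fields N1, N2, N3, N4 on ℝ^7 defined in the context satisfy [N1, k2·N2 + k3·N3 + k4·N4] = k2·∂y1 + k3·∂y2 + k4·∂y3; in particular, the triple (N1, k2·N2 + k3·N3 + k4·N4, k2·∂y1 + k3·∂y2 + k4·∂y3) spans a Lie subalgebra with Heisenberg bracket relations. -/
noncomputable def dy1 : Fin 7 → ℝ := ![0, 0, 0, 0, 1, 0, 0]
noncomputable def dy2 : Fin 7 → ℝ := ![0, 0, 0, 0, 0, 1, 0]
noncomputable def dy3 : Fin 7 → ℝ := ![0, 0, 0, 0, 0, 0, 1]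

/-- The derivative of `N1` at any point, applied to a vector. -/
lemma fderiv_N1_apply (p v : Fin 7 → ℝ) :
    fderiv ℝ N1 p v = ![0, 0, 0, 0, Real.sqrt 3 / 2 * v 0 - v 1, -v 2,
      -(Real.sqrt 3 / 2 * v 0) - v 3] := by
  have hd : ∀ i, DifferentiableAt ℝ (fun q => N1 q i) p := by
    intro i
    fin_cases i <;> simp [N1] <;> fun_prop
  have hp (j : Fin 7) : HasFDerivAt (fun q : Fin 7 → ℝ => q j)
      (ContinuousLinearMap.proj (R := ℝ) (φ := fun _ : Fin 7 => ℝ) j) p :=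
    hasFDerivAt_apply j p
  have h4 := ((((hp 0).const_mul (-Real.sqrt 3 / 2)).add (hp 1)).sub_const 1).neg
  have h5 := ((hp 2).sub_const 1).neg
  have h6 := ((((hp 0).const_mul (Real.sqrt 3 / 2)).add (hp 3)).sub_const 1).neg
  ext i
  have hi : fderiv ℝ N1 p v i = fderiv ℝ (fun q => N1 q i) p v := by
    rw [fderiv_apply (differentiableAt_pi.2 hd)]
    rfl
  rw [hi]
  fin_cases i
  · simp [N1]
  · simp [N1]
  · simp [N1]
  · simp [N1]
  · refine (congrArg (fun L => L v) h4.fderiv).trans ?_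
    simp
    ring
  · refine (congrArg (fun L => L v) h5.fderiv).trans ?_
    simp
  · refine (congrArg (fun L => L v) h6.fderiv).trans ?_
    simp
    ring

theorem stmt_5 (k2 k3 k4 : ℝ) :
    -- the main bracket relation
    lieBracket N1 (fun p => k2 • N2 p + k3 • N3 p + k4 • N4 p)
      = (fun _ => k2 • dy1 + k3 • dy2 + k4 • dy3) ∧
    -- Heisenberg relations: the "center" commutes with both generators
    lieBracket N1 (fun _ => k2 • dy1 + k3 • dy2 + k4 • dy3)
      = (fun _ => (0 : Fin 7 → ℝ)) ∧
    lieBracket (fun p => k2 • N2 p + k3 • N3 p + k4 • N4 p)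
        (fun _ => k2 • dy1 + k3 • dy2 + k4 • dy3)
      = (fun _ => (0 : Fin 7 → ℝ)) := by
  refine ⟨?_, ?_, ?_⟩ <;> funext p
  · ext i
    fin_cases i <;> simp [lieBracket, fderiv_N1_apply, N2, N3, N4, dy1, dy2, dy3]
  · ext i
    fin_cases i <;> simp [lieBracket, fderiv_N1_apply, dy1, dy2, dy3]
  · simp [lieBracket, N2, N3, N4]
end

section
/- The vector fields v1, v2, v3 on ℝ^7 defined in the context satisfy the so(3) bracket relations [v1, v2] = −v3, [v1, v3] = v2, and [v2, v3] = −v1. -/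
noncomputable def v1 : (Fin 7 → ℝ) → (Fin 7 → ℝ) := fun p =>
  ![0, 0, -p 3, p 2, 0,
    -((Real.sqrt 3 / 4) * (p 0) ^ 2 - p 0 + p 6),
    -(p 0 - p 5)]

noncomputable def v2 : (Fin 7 → ℝ) → (Fin 7 → ℝ) := fun p =>
  ![0, p 3, 0, -p 1,
    (Real.sqrt 3 / 4) * (p 0) ^ 2 - p 0 + p 6,
    0,
    (Real.sqrt 3 / 4) * (p 0) ^ 2 + p 0 - p 4]

noncomputable def v3 : (Fin 7 → ℝ) → (Fin 7 → ℝ) := fun p =>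
  ![0, -p 2, p 1, 0,
    p 0 - p 5,
    -((Real.sqrt 3 / 4) * (p 0) ^ 2 + p 0 - p 4),
    0]

/-- If a differentiable map restricts to a quadratic polynomial `f p + t • a + t ^ 2 • b` on the
line through `p` in direction `w`, then its derivative at `p` sends `w` to `a`. -/
theorem fderiv_apply_eq_of_quadratic_on_line {E F : Type*} [NormedAddCommGroup E]
    [NormedSpace ℝ E] [NormedAddCommGroup F] [NormedSpace ℝ F] {f : E → F} {p w : E} {a b : F}
    (hf : DifferentiableAt ℝ f p) (h : ∀ t : ℝ, f (p + t • w) = f p + t • a + t ^ 2 • b) :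
    fderiv ℝ f p w = a := by
  rw [← hf.lineDeriv_eq_fderiv, lineDeriv]
  simp only [h]
  have h1 : HasDerivAt (fun t : ℝ => f p + t • a + t ^ 2 • b) a 0 := by
    simpa using (((hasDerivAt_id' (0 : ℝ)).smul_const a).const_add (f p)).fun_add
      ((hasDerivAt_pow 2 (0 : ℝ)).smul_const b)
  exact h1.deriv

theorem differentiable_v1 : Differentiable ℝ v1 := by
  refine differentiable_pi.2 fun i => ?_
  fin_cases i <;> simp [v1] <;> fun_prop

theorem differentiable_v2 : Differentiable ℝ v2 := by
  refine differentiable_pi.2 fun i => ?_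
  fin_cases i <;> simp [v2] <;> fun_prop

theorem differentiable_v3 : Differentiable ℝ v3 := by
  refine differentiable_pi.2 fun i => ?_
  fin_cases i <;> simp [v3] <;> fun_prop

theorem fderiv_v1_apply (p w : Fin 7 → ℝ) :
    fderiv ℝ v1 p w = ![0, 0, -w 3, w 2, 0,
      -((Real.sqrt 3 / 4) * (2 * p 0 * w 0) - w 0 + w 6), -(w 0 - w 5)] := by
  refine fderiv_apply_eq_of_quadratic_on_line
    (b := ![0, 0, 0, 0, 0, -((Real.sqrt 3 / 4) * w 0 ^ 2), 0]) (differentiable_v1 p) fun t => ?_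
  ext i
  fin_cases i <;> simp [v1] <;> ring

theorem fderiv_v2_apply (p w : Fin 7 → ℝ) :
    fderiv ℝ v2 p w = ![0, w 3, 0, -w 1,
      (Real.sqrt 3 / 4) * (2 * p 0 * w 0) - w 0 + w 6, 0,
      (Real.sqrt 3 / 4) * (2 * p 0 * w 0) + w 0 - w 4] := by
  refine fderiv_apply_eq_of_quadratic_on_line
    (b := ![0, 0, 0, 0, (Real.sqrt 3 / 4) * w 0 ^ 2, 0, (Real.sqrt 3 / 4) * w 0 ^ 2])
    (differentiable_v2 p) fun t => ?_
  ext i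
  fin_cases i <;> simp [v2] <;> ring

theorem fderiv_v3_apply (p w : Fin 7 → ℝ) :
    fderiv ℝ v3 p w = ![0, -w 2, w 1, 0, w 0 - w 5,
      -((Real.sqrt 3 / 4) * (2 * p 0 * w 0) + w 0 - w 4), 0] := by
  refine fderiv_apply_eq_of_quadratic_on_line
    (b := ![0, 0, 0, 0, 0, -((Real.sqrt 3 / 4) * w 0 ^ 2), 0]) (differentiable_v3 p) fun t => ?_
  ext i
  fin_cases i <;> simp [v3] <;> ring

theorem stmt_7 :
    lieBracket v1 v2 = (fun p => -(v3 p)) ∧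
    lieBracket v1 v3 = (fun p => v2 p) ∧
    lieBracket v2 v3 = (fun p => -(v1 p)) := by
  refine ⟨?_, ?_, ?_⟩ <;> ext p i <;>
    simp only [lieBracket, fderiv_v1_apply, fderiv_v2_apply, fderiv_v3_apply] <;>
    fin_cases i <;> simp [v1, v2, v3]
end

section
/- The vector fields v1, v2, v3 preserve the distribution V = span{N2, N3, N4}: one has [v1, N2] = 0, [v1, N3] = −N4, [v1, N4] = N3; [v2, N2] = N4, [v2, N3] = 0, [v2, N4] = −N2; [v3, N2] = −N3, [v3, N3] = N2, [v3, N4] = 0, as identities of vector fields on ℝ^7. -/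
/-- If `X` is differentiable and affine along the lines of direction `w`, with slope `u`, then its
Lie bracket with the constant vector field `w` is `-u`. -/
theorem lieBracket_const_of_affine {X : (Fin 7 → ℝ) → (Fin 7 → ℝ)} (hX : Differentiable ℝ X)
    (w u : Fin 7 → ℝ) (h : ∀ (p : Fin 7 → ℝ) (t : ℝ), X (p + t • w) = X p + t • u) :
    lieBracket X (fun _ => w) = fun _ => -u := by
  funext p
  have h₁ : HasLineDerivAt ℝ X (fderiv ℝ X p w) p w := (hX p).hasFDerivAt.hasLineDerivAt w
  have h₂ : HasLineDerivAt ℝ X u p w := by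
    simp only [HasLineDerivAt, h]
    simpa using ((hasDerivAt_id (0 : ℝ)).smul_const u).const_add (X p)
  simp [lieBracket, h₁.unique h₂]

theorem stmt_9 :
    lieBracket v1 N2 = (fun _ => (0 : Fin 7 → ℝ)) ∧
    lieBracket v1 N3 = (fun p => -(N4 p)) ∧
    lieBracket v1 N4 = (fun p => N3 p) ∧
    lieBracket v2 N2 = (fun p => N4 p) ∧
    lieBracket v2 N3 = (fun _ => (0 : Fin 7 → ℝ)) ∧
    lieBracket v2 N4 = (fun p => -(N2 p)) ∧
    lieBracket v3 N2 = (fun p => -(N3 p)) ∧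
    lieBracket v3 N3 = (fun p => N2 p) ∧
    lieBracket v3 N4 = (fun _ => (0 : Fin 7 → ℝ)) := by
  refine ⟨?_, ?_, ?_, ?_, ?_, ?_, ?_, ?_, ?_⟩
  · refine (lieBracket_const_of_affine differentiable_v1 (N2 0) 0 fun p t => ?_).trans ?_
    · ext i
      fin_cases i <;> simp [v1, N2]
    · simp
  · refine (lieBracket_const_of_affine differentiable_v1 (N3 0) (N4 0) fun p t => ?_).trans ?_
    · ext i
      fin_cases i <;> simp [v1, N3, N4]
    · simp [N4]
  · refine (lieBracket_const_of_affine differentiable_v1 (N4 0) (-N3 0) fun p t => ?_).trans ?_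
    · ext i
      fin_cases i <;> simp [v1, N4, N3]
      ring
    · simp [N3]
  · refine (lieBracket_const_of_affine differentiable_v2 (N2 0) (-N4 0) fun p t => ?_).trans ?_
    · ext i
      fin_cases i <;> simp [v2, N2, N4]
      ring
    · simp [N4]
  · refine (lieBracket_const_of_affine differentiable_v2 (N3 0) 0 fun p t => ?_).trans ?_
    · ext i
      fin_cases i <;> simp [v2, N3]
    · simp
  · refine (lieBracket_const_of_affine differentiable_v2 (N4 0) (N2 0) fun p t => ?_).trans ?_
    · ext i
      fin_cases i <;> simp [v2, N4, N2]
    · simp [N2]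
  · refine (lieBracket_const_of_affine differentiable_v3 (N2 0) (N3 0) fun p t => ?_).trans ?_
    · ext i
      fin_cases i <;> simp [v3, N2, N3]
    · simp [N3]
  · refine (lieBracket_const_of_affine differentiable_v3 (N3 0) (-N2 0) fun p t => ?_).trans ?_
    · ext i
      fin_cases i <;> simp [v3, N3, N2]
      ring
    · simp [N2]
  · refine (lieBracket_const_of_affine differentiable_v3 (N4 0) 0 fun p t => ?_).trans ?_
    · ext i
      fin_cases i <;> simp [v3, N4]
    · simp
end

section
/- Let h = (h1, …, h7) : ℝ → ℝ^7 be a differentiable solution of the fibre (vertical) Hamiltonian system defined in the context. Then h5, h6, h7 are constant functions, h1 is twice differentiable, and h1 satisfies the harmonic oscillator equation h1''(t) = −K²·h1(t) for all t, where K² = h5(0)² + h6(0)² + h7(0)². -/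
theorem stmt_11 (h1 h2 h3 h4 h5 h6 h7 : ℝ → ℝ)
    (hd1 : Differentiable ℝ h1) (hd2 : Differentiable ℝ h2)
    (hd3 : Differentiable ℝ h3) (hd4 : Differentiable ℝ h4)
    (hd5 : Differentiable ℝ h5) (hd6 : Differentiable ℝ h6)
    (hd7 : Differentiable ℝ h7)
    (e1 : ∀ t, deriv h1 t = -(h5 t * h2 t) - h6 t * h3 t - h7 t * h4 t)
    (e2 : ∀ t, deriv h2 t = h5 t * h1 t)
    (e3 : ∀ t, deriv h3 t = h6 t * h1 t)
    (e4 : ∀ t, deriv h4 t = h7 t * h1 t)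
    (e5 : ∀ t, deriv h5 t = 0)
    (e6 : ∀ t, deriv h6 t = 0)
    (e7 : ∀ t, deriv h7 t = 0) :
    (∀ t, h5 t = h5 0) ∧ (∀ t, h6 t = h6 0) ∧ (∀ t, h7 t = h7 0) ∧
    Differentiable ℝ (deriv h1) ∧
    (∀ t, deriv (deriv h1) t = -((h5 0) ^ 2 + (h6 0) ^ 2 + (h7 0) ^ 2) * h1 t) := by
  have c5 : ∀ t, h5 t = h5 0 := fun t => is_const_of_deriv_eq_zero hd5 e5 t 0
  have c6 : ∀ t, h6 t = h6 0 := fun t => is_const_of_deriv_eq_zero hd6 e6 t 0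
  have c7 : ∀ t, h7 t = h7 0 := fun t => is_const_of_deriv_eq_zero hd7 e7 t 0
  have hderiv : deriv h1 = fun t => -(h5 0 * h2 t) - h6 0 * h3 t - h7 0 * h4 t := by
    funext t
    rw [e1, c5 t, c6 t, c7 t]
  have hsecond : ∀ t, HasDerivAt (deriv h1)
      (-((h5 0) ^ 2 + (h6 0) ^ 2 + (h7 0) ^ 2) * h1 t) t := by
    intro t
    rw [hderiv]
    have d2 := (hd2 t).hasDerivAt.const_mul (h5 0)
    have d3 := (hd3 t).hasDerivAt.const_mul (h6 0)
    have d4 := (hd4 t).hasDerivAt.const_mul (h7 0)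
    refine ((d2.fun_neg.fun_sub d3).fun_sub d4).congr_deriv ?_
    rw [e2, e3, e4, c5 t, c6 t, c7 t]
    ring
  exact ⟨c5, c6, c7, fun t => (hsecond t).differentiableAt, fun t => (hsecond t).deriv⟩
end

section
/- Let C5, C6, C7, C11, C12, C13, C14, C15 be real constants with (C5, C6, C7) ≠ (0, 0, 0), set K = √(C5² + C6² + C7²), and assume C5·C13 + C6·C14 + C7·C15 = 0. Define h1(t) = C11·cos(Kt) + C12·sin(Kt), h2(t) = (C5/K)(C11·sin(Kt) − C12·cos(Kt)) + C13, h3(t) = (C6/K)(C11·sin(Kt) − C12·cos(Kt)) + C14, h4(t) = (C7/K)(C11·sin(Kt) − C12·cos(Kt)) + C15, h5(t) = C5, h6(t) = C6, h7(t) = C7. Then (h1, …, h7) is a solution of the fibre (vertical) Hamiltonian system defined in the context. -/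
theorem hasDerivAt_const_mul_trig (K a b t : ℝ) :
    HasDerivAt (fun t => a * Real.cos (K * t) + b * Real.sin (K * t))
      (-(K * (a * Real.sin (K * t) - b * Real.cos (K * t)))) t := by
  have hlin : HasDerivAt (fun t => K * t) K t := by
    simpa using (hasDerivAt_id t).const_mul K
  refine ((hlin.cos.const_mul a).add (hlin.sin.const_mul b)).congr_deriv ?_
  ring

theorem hasDerivAt_div_mul_trig_add {K : ℝ} (hK : K ≠ 0) (a b c d t : ℝ) :
    HasDerivAt (fun t => c / K * (a * Real.sin (K * t) - b * Real.cos (K * t)) + d)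
      (c * (a * Real.cos (K * t) + b * Real.sin (K * t))) t := by
  have hlin : HasDerivAt (fun t => K * t) K t := by
    simpa using (hasDerivAt_id t).const_mul K
  refine ((((hlin.sin.const_mul a).sub (hlin.cos.const_mul b)).const_mul
    (c / K)).add_const d).congr_deriv ?_
  field_simp
  ring

theorem stmt_13 (C5 C6 C7 C11 C12 C13 C14 C15 : ℝ)
    (hC : (C5, C6, C7) ≠ ((0 : ℝ), (0 : ℝ), (0 : ℝ)))
    (horth : C5 * C13 + C6 * C14 + C7 * C15 = 0) :
    let K := Real.sqrt (C5 ^ 2 + C6 ^ 2 + C7 ^ 2)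
    let h1 : ℝ → ℝ := fun t => C11 * Real.cos (K * t) + C12 * Real.sin (K * t)
    let h2 : ℝ → ℝ := fun t => (C5 / K) * (C11 * Real.sin (K * t) - C12 * Real.cos (K * t)) + C13
    let h3 : ℝ → ℝ := fun t => (C6 / K) * (C11 * Real.sin (K * t) - C12 * Real.cos (K * t)) + C14
    let h4 : ℝ → ℝ := fun t => (C7 / K) * (C11 * Real.sin (K * t) - C12 * Real.cos (K * t)) + C15
    let h5 : ℝ → ℝ := fun _ => C5
    let h6 : ℝ → ℝ := fun _ => C6
    let h7 : ℝ → ℝ := fun _ => C7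
    ∀ t : ℝ,
      HasDerivAt h1 (-(h5 t * h2 t) - h6 t * h3 t - h7 t * h4 t) t ∧
      HasDerivAt h2 (h5 t * h1 t) t ∧
      HasDerivAt h3 (h6 t * h1 t) t ∧
      HasDerivAt h4 (h7 t * h1 t) t ∧
      HasDerivAt h5 0 t ∧
      HasDerivAt h6 0 t ∧
      HasDerivAt h7 0 t := by
  intro K h1 h2 h3 h4 h5 h6 h7 t
  have hpos : 0 < C5 ^ 2 + C6 ^ 2 + C7 ^ 2 := by
    by_contra! h
    apply hC
    have e5 : C5 = 0 := by nlinarith [sq_nonneg C5, sq_nonneg C6, sq_nonneg C7]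
    have e6 : C6 = 0 := by nlinarith [sq_nonneg C5, sq_nonneg C6, sq_nonneg C7]
    have e7 : C7 = 0 := by nlinarith [sq_nonneg C5, sq_nonneg C6, sq_nonneg C7]
    rw [e5, e6, e7]
  have hK : K ≠ 0 := (Real.sqrt_pos.2 hpos).ne'
  have hKsq : K ^ 2 = C5 ^ 2 + C6 ^ 2 + C7 ^ 2 := Real.sq_sqrt hpos.le
  refine ⟨?_, hasDerivAt_div_mul_trig_add hK C11 C12 C5 C13 t,
    hasDerivAt_div_mul_trig_add hK C11 C12 C6 C14 t,
    hasDerivAt_div_mul_trig_add hK C11 C12 C7 C15 t,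
    hasDerivAt_const t C5, hasDerivAt_const t C6, hasDerivAt_const t C7⟩
  convert hasDerivAt_const_mul_trig K C11 C12 t using 1
  simp only [h2, h3, h4, h5, h6, h7]
  clear_value K
  generalize C11 * Real.sin (K * t) - C12 * Real.cos (K * t) = S
  have hsum : (C5 ^ 2 + C6 ^ 2 + C7 ^ 2) / K = K := by
    rw [← hKsq]
    field_simp
  linear_combination -S * hsum - horth
end
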